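/- arXiv:1504.05835 — 2 statements merged into one kernel-verified Lean document; each statement's English description precedes it below -/
import Mathlib

section
/- Let p ∈ (0,1), t > 0 and y real with |y| < t and y ≠ 0. Writing K(x,w) = ( p²(w−x) + (1−p)²(w+x) )^{−3/2}, one has ( p²(1−p)/(2^{3/2} π) ) ∫_{−t}^{y} ∫_{max(|x|, t−y+x)}^{t} K(x,w) (y − x)^{−3/2} dw dx + ( p(1−p)²/(2^{3/2} π) ) ∫_{y}^{t} ∫_{max(|x|, t+y−x)}^{t} K(x,w) (x − y)^{−3/2} dw dx = ( p(1−p) t^{1/2} / π ) · [ t( (t−y)^{1/2} − (t+y)^{1/2} ) + y( (t−y)^{1/2} + (t+y)^{1/2} ) ] / [ y (t−y)^{1/2} (t+y)^{1/2} ( (1 − 2p(1−p)) t + (1−2p) y ) ]. Both sides equal the density w_t(y) of the jump-first Lévy walk limit Y(t) = L_{1/2}(S_{1/2}^{−1}(t)) at a point y with |y| < t. -/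
open MeasureTheory Set

lemma aux_rpow (z : ℝ) (hz : 0 < z) : z ^ (-(3:ℝ)/2) = 1 / (z * √z) := by
  have h : (-(3:ℝ)/2) = -(1 + 1/2) := by norm_num
  rw [h, Real.rpow_neg hz.le, Real.rpow_add hz, Real.rpow_one, ← Real.sqrt_eq_rpow, one_div]

lemma aux_deriv (α β y x : ℝ) (hx : x < y) (hu : 0 < α + β * x) :
    HasDerivAt (fun x => √(α + β * x) / √(y - x))
      ((α + β * y) / 2 / (√(α + β * x) * ((y - x) * √(y - x)))) x := by
  have hyx : 0 < y - x := by linarith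
  have h1 : HasDerivAt (fun x => α + β * x) β x := by
    simpa using ((hasDerivAt_id x).const_mul β).const_add α
  have h2 : HasDerivAt (fun x => y - x) (-1) x := by
    simpa using (hasDerivAt_id x).const_sub y
  have h3 := (h1.sqrt hu.ne').div (h2.sqrt hyx.ne') (Real.sqrt_pos.2 hyx).ne'
  refine h3.congr_deriv ?_
  have s1 := Real.sqrt_pos.2 hu
  have s2 := Real.sqrt_pos.2 hyx
  have e1 := Real.sq_sqrt hu.le
  have e2 := Real.sq_sqrt hyx.le
  generalize √(α + β * x) = a at *
  generalize √(y - x) = b at *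
  rw [← e2]
  field_simp
  rw [e2, e1]
  ring

lemma aux_inner (p q t y x m : ℝ) (hp : 0 < p) (hq : 0 < q) (hxy : x < y)
    (hm : |x| ≤ m) (hmt : m ≤ t) (hpos : 0 < m) :
    (∫ w in m..t, (p^2 * (w - x) + q^2 * (w + x)) ^ (-(3:ℝ)/2) * (y - x) ^ (-(3:ℝ)/2))
      = (2 / (p^2 + q^2)) * (1 / √(p^2 * (m - x) + q^2 * (m + x))
          - 1 / √(p^2 * (t - x) + q^2 * (t + x))) / ((y - x) * √(y - x)) := by
  have hyx : 0 < y - x := by linarith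
  obtain ⟨hx1, hx2⟩ := abs_le.1 hm
  have hw : ∀ w, m ≤ w → 0 < p^2 * (w - x) + q^2 * (w + x) := by
    intro w hw
    have hp2 : 0 < p^2 := by positivity
    have hq2 : 0 < q^2 := by positivity
    rcases le_or_gt x 0 with h | h
    · have : 0 < w - x := by linarith
      have : 0 ≤ w + x := by linarith
      positivity
    · have : 0 ≤ w - x := by linarith
      have : 0 < w + x := by linarith
      positivity
  have hd : ∀ w ∈ uIcc m t, HasDerivAt
      (fun w => -(2 / (p^2+q^2)) * (1 / √(p^2 * (w - x) + q^2 * (w + x))))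
      ((p^2 * (w - x) + q^2 * (w + x)) ^ (-(3:ℝ)/2)) w := by
    intro w hw'
    rw [uIcc_of_le hmt] at hw'
    have h0 := hw w hw'.1
    rw [aux_rpow _ h0]
    have h1 : HasDerivAt (fun w => p^2 * (w - x) + q^2 * (w + x)) (p^2 + q^2) w := by
      have h := (((hasDerivAt_id w).sub_const x).const_mul (p^2)).add
        (((hasDerivAt_id w).add_const x).const_mul (q^2))
      exact h.congr_deriv (by ring)
    have h2 := ((h1.sqrt h0.ne').inv (Real.sqrt_pos.2 h0).ne').const_mul (-(2 / (p^2+q^2)))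
    simp only [one_div]
    refine h2.congr_deriv ?_
    have s1 := Real.sqrt_pos.2 h0
    rw [Real.sq_sqrt h0.le]
    have : 0 < p^2+q^2 := by positivity
    field_simp
  have hc : ContinuousOn (fun w => (p^2 * (w - x) + q^2 * (w + x)) ^ (-(3:ℝ)/2)) (uIcc m t) := by
    apply ContinuousOn.rpow_const
    · fun_prop
    · intro w hw'
      rw [uIcc_of_le hmt] at hw'
      exact Or.inl (hw w hw'.1).ne'
  rw [intervalIntegral.integral_mul_const,
    intervalIntegral.integral_eq_sub_of_hasDerivAt hd hc.intervalIntegrable, aux_rpow _ hyx]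
  ring

lemma aux_main (p q t y : ℝ) (hp : 0 < p) (hq : 0 < q) (hy₀ : y ≠ 0) (hyt : |y| < t) :
    (∫ x in (-t)..y, ∫ w in (max |x| (t - y + x))..t,
          (p^2 * (w - x) + q^2 * (w + x)) ^ (-(3:ℝ)/2) * (y - x) ^ (-(3:ℝ)/2))
     = 2 * √2 * √(t + y) * (√t - √(t - y)) /
        (p * y * ((p^2 + q^2) * t + (q^2 - p^2) * y)) := by
  obtain ⟨hy1, hy2⟩ := abs_lt.1 hyt
  have hp2 : 0 < p^2 := by positivity
  have hq2 : 0 < q^2 := by positivity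
  have hA : 0 < p^2 + q^2 := by positivity
  have hD' : ∀ x, -t ≤ x → x ≤ t → 0 < (p^2 + q^2) * t + (q^2 - p^2) * x := by
    intro x h1 h2
    have : (p^2 + q^2) * t + (q^2 - p^2) * x = p^2 * (t - x) + q^2 * (t + x) := by ring
    rw [this]
    rcases le_or_gt x 0 with h | h
    · have : 0 < t - x := by linarith
      have : 0 ≤ t + x := by linarith
      positivity
    · have : 0 ≤ t - x := by linarith
      have : 0 < t + x := by linarith
      positivity
  have hD := hD' y hy1.le hy2.le
  have hU : ∀ x, (y - t)/2 ≤ x → 0 < (p^2 + q^2) * (t - y) + 2 * q^2 * x := by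
    intro x hx
    have : 0 < p^2 * (t - y) := mul_pos hp2 (by linarith)
    nlinarith
  set D := (p^2 + q^2) * t + (q^2 - p^2) * y with hDdef
  set f : ℝ → ℝ := fun x => ∫ w in (max |x| (t - y + x))..t,
          (p^2 * (w - x) + q^2 * (w + x)) ^ (-(3:ℝ)/2) * (y - x) ^ (-(3:ℝ)/2) with hf
  have hmle : ∀ x, -t < x → x < y → max |x| (t - y + x) ≤ t := by
    intro x h1 h2
    apply max_le
    · exact abs_le.2 ⟨by linarith, by linarith⟩
    · linarith
  have hmpos : ∀ x, 0 < max |x| (t - y + x) := by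
    intro x
    rcases eq_or_ne x 0 with rfl | h
    · exact lt_max_of_lt_right (by linarith)
    · exact lt_max_of_lt_left (abs_pos.2 h)
  have hfeq : ∀ x, -t < x → x < y → f x = _ := fun x h1 h2 =>
    aux_inner p q t y x _ hp hq h2 (le_max_left _ _) (hmle x h1 h2) (hmpos x)
  have hfnn : ∀ x, -t < x → x < y → 0 ≤ f x := by
    intro x h1 h2
    apply intervalIntegral.integral_nonneg (hmle x h1 h2)
    intro w hw
    have hw1 : |x| ≤ w := (le_max_left _ _).trans hw.1
    obtain ⟨h3, h4⟩ := abs_le.1 hw1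
    have : 0 ≤ w - x := by linarith
    have : 0 ≤ w + x := by linarith
    have : 0 ≤ y - x := by linarith
    positivity
  -- antiderivatives
  set F3 : ℝ → ℝ := fun x => 2 / D * (√((p^2 + q^2) * t + (q^2 - p^2) * x) / √(y - x)) with hF3
  set F1 : ℝ → ℝ := fun x => - 1 / (p^2 * y) * (√(0 + (-(2 * p^2)) * x) / √(y - x)) with hF1
  set F2 : ℝ → ℝ := fun x => 2 / D * (√((p^2 + q^2) * (t - y) + 2 * q^2 * x) / √(y - x)) with hF2
  set G1 : ℝ → ℝ := fun x => 2 / (p^2 + q^2) * (F1 x - F3 x) with hG1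
  set G2 : ℝ → ℝ := fun x => - (4 / D) * √(y - x) /
    (√((p^2 + q^2) * (t - y) + 2 * q^2 * x) + √((p^2 + q^2) * t + (q^2 - p^2) * x)) with hG2
  have hG2eq : ∀ x, (y - t)/2 ≤ x → x < y → G2 x = 2 / (p^2 + q^2) * (F2 x - F3 x) := by
    intro x h1 h2
    have hu := hU x h1
    have hv := hD' x (by linarith) (by linarith)
    have hyx : 0 < y - x := by linarith
    have s1 := Real.sqrt_pos.2 hu
    have s2 := Real.sqrt_pos.2 hv
    have s3 := Real.sqrt_pos.2 hyx
    have e1 := Real.sq_sqrt hu.le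
    have e2 := Real.sq_sqrt hv.le
    have e3 := Real.sq_sqrt hyx.le
    simp only [hG2, hF2, hF3]
    generalize √((p^2 + q^2) * (t - y) + 2 * q^2 * x) = a at *
    generalize √((p^2 + q^2) * t + (q^2 - p^2) * x) = b at *
    generalize √(y - x) = c at *
    have key : a^2 - b^2 = - (p^2+q^2) * c^2 := by rw [e1, e2, e3]; ring
    have : 0 < a + b := by positivity
    clear_value D
    field_simp
    linear_combination (-4) * key
  have hd3 : ∀ x, -t < x → x < y → HasDerivAt F3
      (1 / √(p^2 * (t - x) + q^2 * (t + x)) / ((y - x) * √(y - x))) x := by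
    intro x h1 h2
    have hv := hD' x (by linarith) (by linarith)
    have := (aux_deriv ((p^2 + q^2) * t) (q^2 - p^2) y x h2 hv).const_mul (2 / D)
    refine this.congr_deriv ?_
    have e : p^2 * (t - x) + q^2 * (t + x) = (p^2 + q^2) * t + (q^2 - p^2) * x := by ring
    rw [e, ← hDdef]
    have s2 := Real.sqrt_pos.2 hv
    have hyx : 0 < y - x := by linarith
    have s3 := Real.sqrt_pos.2 hyx
    clear_value D
    field_simp
  have hd2 : ∀ x, (y - t)/2 < x → x < y → HasDerivAt F2
      (1 / √((p^2 + q^2) * (t - y) + 2 * q^2 * x) / ((y - x) * √(y - x))) x := by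
    intro x h1 h2
    have hv := hU x h1.le
    have := (aux_deriv ((p^2 + q^2) * (t - y)) (2 * q^2) y x h2 hv).const_mul (2 / D)
    refine this.congr_deriv ?_
    have e : (p^2 + q^2) * (t - y) + 2 * q^2 * y = D := by rw [hDdef]; ring
    rw [e]
    have s2 := Real.sqrt_pos.2 hv
    have hyx : 0 < y - x := by linarith
    have s3 := Real.sqrt_pos.2 hyx
    clear_value D
    field_simp
  have hd1 : ∀ x, x < (y - t)/2 → HasDerivAt F1
      (1 / √(0 + (-(2 * p^2)) * x) / ((y - x) * √(y - x))) x := by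
    intro x h1
    have hv : 0 < 0 + (-(2 * p^2)) * x := by nlinarith
    have h2 : x < y := by linarith
    have := (aux_deriv 0 (-(2 * p^2)) y x h2 hv).const_mul (- 1 / (p^2 * y))
    refine this.congr_deriv ?_
    have s2 := Real.sqrt_pos.2 hv
    have hyx : 0 < y - x := by linarith
    have s3 := Real.sqrt_pos.2 hyx
    field_simp
    ring
  have hdG1 : ∀ x ∈ Ioo (-t) ((y - t)/2), HasDerivAt G1 (f x) x := by
    intro x hx
    have hxy : x < y := by linarith [hx.2]
    have hx0 : x < 0 := by linarith [hx.2]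
    have := ((hd1 x hx.2).sub (hd3 x hx.1 hxy)).const_mul (2 / (p^2 + q^2))
    refine this.congr_deriv ?_
    rw [hfeq x hx.1 hxy]
    have hm : max |x| (t - y + x) = -x := by
      rw [abs_of_neg hx0]; exact max_eq_left (by linarith [hx.2])
    rw [hm]
    have e : p^2 * (-x - x) + q^2 * (-x + x) = 0 + (-(2 * p^2)) * x := by ring
    rw [e]
    ring
  have hdG2 : ∀ x ∈ Ioo ((y - t)/2) y, HasDerivAt G2 (f x) x := by
    intro x hx
    have hxt : -t < x := by linarith [hx.1]
    have := ((hd2 x hx.1 hx.2).sub (hd3 x hxt hx.2)).const_mul (2 / (p^2 + q^2))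
    have hev : G2 =ᶠ[nhds x] fun x => 2 / (p^2 + q^2) * (F2 x - F3 x) := by
      filter_upwards [Ioo_mem_nhds hx.1 hx.2] with z hz
      exact hG2eq z hz.1.le hz.2
    refine (this.congr_of_eventuallyEq hev).congr_deriv ?_
    rw [hfeq x hxt hx.2]
    have hm : max |x| (t - y + x) = t - y + x := by
      apply max_eq_right
      apply abs_le.2 ⟨by linarith [hx.1], by linarith⟩
    rw [hm]
    have e : p^2 * (t - y + x - x) + q^2 * (t - y + x + x)
      = (p^2 + q^2) * (t - y) + 2 * q^2 * x := by ring
    rw [e]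
    ring
  have hcG1 : ContinuousOn G1 (Icc (-t) ((y - t)/2)) := by
    have hne : ∀ x ∈ Icc (-t) ((y - t)/2), √(y - x) ≠ 0 := by
      intro x hx
      exact (Real.sqrt_pos.2 (by linarith [hx.2])).ne'
    simp only [hG1, hF1, hF3]
    apply ContinuousOn.mul continuousOn_const
    apply ContinuousOn.sub
    · apply ContinuousOn.mul continuousOn_const
      exact ContinuousOn.div (by fun_prop) (by fun_prop) hne
    · apply ContinuousOn.mul continuousOn_const
      exact ContinuousOn.div (by fun_prop) (by fun_prop) hne
  have hcG2 : ContinuousOn G2 (Icc ((y - t)/2) y) := by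
    simp only [hG2]
    refine ContinuousOn.div (by fun_prop) (by fun_prop) ?_
    intro x hx
    have := Real.sqrt_pos.2 (hU x hx.1)
    positivity
  have hc1 : -t ≤ (y - t)/2 := by linarith
  have hc2 : (y - t)/2 ≤ y := by linarith
  have hi1 : IntervalIntegrable f volume (-t) ((y - t)/2) := by
    rw [intervalIntegrable_iff_integrableOn_Ioc_of_le hc1]
    exact intervalIntegral.integrableOn_deriv_of_nonneg hcG1 hdG1
      (fun x hx => hfnn x hx.1 (by linarith [hx.2]))
  have hi2 : IntervalIntegrable f volume ((y - t)/2) y := by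
    rw [intervalIntegrable_iff_integrableOn_Ioc_of_le hc2]
    exact intervalIntegral.integrableOn_deriv_of_nonneg hcG2 hdG2
      (fun x hx => hfnn x (by linarith [hx.1]) hx.2)
  rw [← intervalIntegral.integral_add_adjacent_intervals hi1 hi2,
    intervalIntegral.integral_eq_sub_of_hasDerivAt_of_le hc1 hcG1 hdG1 hi1,
    intervalIntegral.integral_eq_sub_of_hasDerivAt_of_le hc2 hcG2 hdG2 hi2,
    hG2eq _ le_rfl (by linarith)]
  have g0 : G2 y = 0 := by simp [hG2]
  rw [g0]
  simp only [hG1, hF1, hF2, hF3]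
  have a1 : 0 + -(2 * p^2) * ((y - t)/2) = p^2 * (t - y) := by ring
  have a2 : (p^2 + q^2) * (t - y) + 2 * q^2 * ((y - t)/2) = p^2 * (t - y) := by ring
  have a3 : 0 + -(2 * p^2) * (-t) = p^2 * (2 * t) := by ring
  have a4 : (p^2 + q^2) * t + (q^2 - p^2) * (-t) = p^2 * (2 * t) := by ring
  have a5 : y - (y - t)/2 = (t + y) / 2 := by ring
  have a6 : y - -t = t + y := by ring
  rw [a1, a2, a3, a4, a5, a6, Real.sqrt_mul hp2.le, Real.sqrt_mul hp2.le, Real.sqrt_sq hp.le,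
    Real.sqrt_mul (by norm_num : (0:ℝ) ≤ 2), Real.sqrt_div (by linarith : 0 ≤ t + y)]
  have hty : 0 < t + y := by linarith
  have s1 := Real.sqrt_pos.2 hty
  have e1 := Real.sq_sqrt hty.le
  have s2 : 0 < √(2:ℝ) := by positivity
  have e2 : √(2:ℝ)^2 = 2 := Real.sq_sqrt (by norm_num)
  generalize √(t + y) = b at *
  generalize √(2:ℝ) = r at *
  generalize √((p^2 + q^2) * t + (q^2 - p^2) * ((y - t)/2)) = s at *
  have hDb : D = (p^2 + q^2) * b^2 - 2 * p^2 * y := by rw [hDdef, e1]; ring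
  clear_value D
  have hDy : D + 2 * p^2 * y = (p^2 + q^2) * b^2 := by rw [hDb]; ring
  field_simp
  linear_combination 2 * r * (√t - √(t-y)) * hDy

/-- Corollary 4, case `|y| < t`: the explicit density of the jump-first Lévy walk limit
`Y(t) = L_{1/2}(S_{1/2}^{−1}(t))` for `α = 1/2`. With
`K(x,w) = (p²(w−x) + (1−p)²(w+x))^{−3/2}`,
`(p²(1−p)/(2^{3/2}π)) ∫_{−t}^{y} ∫_{max(|x|,t−y+x)}^{t} K(x,w) (y−x)^{−3/2} dw dx
 + (p(1−p)²/(2^{3/2}π)) ∫_{y}^{t} ∫_{max(|x|,t+y−x)}^{t} K(x,w) (x−y)^{−3/2} dw dx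
 = (p(1−p)t^{1/2}/π) [t((t−y)^{1/2}−(t+y)^{1/2}) + y((t−y)^{1/2}+(t+y)^{1/2})]
   / [y (t−y)^{1/2} (t+y)^{1/2} ((1−2p(1−p))t + (1−2p)y)]`. -/
theorem jump_first_density_half_middle (p t y : ℝ) (hp : p ∈ Ioo (0:ℝ) 1) (ht : 0 < t)
    (hy₀ : y ≠ 0) (hyt : |y| < t) :
    (p^2 * (1 - p) / (2 ^ ((3:ℝ)/2) * Real.pi)) *
        (∫ x in (-t)..y, ∫ w in (max |x| (t - y + x))..t,
          (p^2 * (w - x) + (1 - p)^2 * (w + x)) ^ (-(3:ℝ)/2) * (y - x) ^ (-(3:ℝ)/2)) +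
      (p * (1 - p)^2 / (2 ^ ((3:ℝ)/2) * Real.pi)) *
        (∫ x in y..t, ∫ w in (max |x| (t + y - x))..t,
          (p^2 * (w - x) + (1 - p)^2 * (w + x)) ^ (-(3:ℝ)/2) * (x - y) ^ (-(3:ℝ)/2))
      = (p * (1 - p) * t ^ ((1:ℝ)/2) / Real.pi) *
          (t * ((t - y) ^ ((1:ℝ)/2) - (t + y) ^ ((1:ℝ)/2)) +
            y * ((t - y) ^ ((1:ℝ)/2) + (t + y) ^ ((1:ℝ)/2))) /
          (y * (t - y) ^ ((1:ℝ)/2) * (t + y) ^ ((1:ℝ)/2) *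
            ((1 - 2*p*(1 - p)) * t + (1 - 2*p) * y)) := by

  obtain ⟨hp0, hp1⟩ := hp
  obtain ⟨hy1, hy2⟩ := abs_lt.1 hyt
  have hq : 0 < 1 - p := by linarith
  have h1 := aux_main p (1 - p) t y hp0 hq hy₀ hyt
  have h2 := aux_main (1 - p) p t (-y) hq hp0 (neg_ne_zero.2 hy₀) (by rwa [abs_neg])
  have h3 : (∫ x in y..t, ∫ w in (max |x| (t + y - x))..t,
          (p^2 * (w - x) + (1 - p)^2 * (w + x)) ^ (-(3:ℝ)/2) * (x - y) ^ (-(3:ℝ)/2))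
      = ∫ x in (-t)..(-y), ∫ w in (max |x| (t - -y + x))..t,
          ((1 - p)^2 * (w - x) + p^2 * (w + x)) ^ (-(3:ℝ)/2) * (-y - x) ^ (-(3:ℝ)/2) := by
    rw [← intervalIntegral.integral_comp_neg]
    simp only [abs_neg]
    congr 1
    ext x
    have e1 : t + y - x = t - -y + -x := by ring
    have e2 : x - y = -y - -x := by ring
    rw [e1, e2]
    congr 1
    ext w
    congr 2
    ring
  rw [h3, h1, h2]
  have hD : 0 < (1 - 2*p*(1 - p)) * t + (1 - 2*p) * y := by
    have : (1 - 2*p*(1 - p)) * t + (1 - 2*p) * y = p^2 * (t - y) + (1-p)^2 * (t + y) := by ring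
    rw [this]
    have : 0 < t - y := by linarith
    have : 0 < t + y := by linarith
    positivity
  have d1 : (p^2 + (1-p)^2) * t + ((1-p)^2 - p^2) * y = (1 - 2*p*(1 - p)) * t + (1 - 2*p) * y := by
    ring
  have d2 : ((1-p)^2 + p^2) * t + (p^2 - (1-p)^2) * (-y)
      = (1 - 2*p*(1 - p)) * t + (1 - 2*p) * y := by
    ring
  have d3 : t - -y = t + y := by ring
  have d4 : t + -y = t - y := by ring
  have d5 : (2:ℝ) ^ ((3:ℝ)/2) = 2 * √2 := by
    have h : ((3:ℝ)/2) = (1 + 1/2) := by norm_num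
    rw [h, Real.rpow_add (by norm_num), Real.rpow_one, ← Real.sqrt_eq_rpow]
  rw [d1, d2, d3, d4, d5, ← Real.sqrt_eq_rpow, ← Real.sqrt_eq_rpow, ← Real.sqrt_eq_rpow]
  have ha : 0 < t - y := by linarith
  have hb : 0 < t + y := by linarith
  have sa := Real.sqrt_pos.2 ha
  have sb := Real.sqrt_pos.2 hb
  have ea := Real.sq_sqrt ha.le
  have eb := Real.sq_sqrt hb.le
  have s2 : 0 < √(2:ℝ) := by positivity
  have hpi := Real.pi_pos
  generalize (1 - 2*p*(1 - p)) * t + (1 - 2*p) * y = D at *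
  generalize √(t - y) = a at *
  generalize √(t + y) = b at *
  generalize √(2:ℝ) = r at *
  generalize √t = s at *
  have key : t * (a - b) + y * (a + b) = a * b * (b - a) := by
    linear_combination (-a) * eb + b * ea
  rw [key]
  field_simp
  ring
end

section
/- Let p ∈ (0,1), t > 0 and y ≤ −t. Writing K(x,w) = ( p²(w−x) + (1−p)²(w+x) )^{−3/2}, one has ( p(1−p)²/(2^{3/2} π) ) ∫_{−t}^{t} ∫_{|x|}^{t} K(x,w) (x − y)^{−3/2} dw dx = ( (1−p)/π ) · t^{1/2} / [ |y| ( p (t−y)^{1/2} + (1−p) (−y−t)^{1/2} ) ]. Both sides equal the density w_t(y) of the jump-first Lévy walk limit Y(t) = L_{1/2}(S_{1/2}^{−1}(t)) at a point y ≤ −t. -/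
open MeasureTheory Set

lemma jf_ftc (F f : ℝ → ℝ) (a b : ℝ) (hab : a ≤ b) (hc : ContinuousOn F (Icc a b))
    (hd : ∀ x ∈ Ioo a b, HasDerivAt F (f x) x) (hn : ∀ x ∈ Ioo a b, 0 ≤ f x) :
    IntervalIntegrable f volume a b ∧ ∫ x in a..b, f x = F b - F a := by
  have hi : IntervalIntegrable f volume a b := by
    rw [intervalIntegrable_iff_integrableOn_Ioc_of_le hab]
    exact intervalIntegral.integrableOn_deriv_of_nonneg hc hd hn
  exact ⟨hi, intervalIntegral.integral_eq_sub_of_hasDerivAt_of_le hab hc hd hi⟩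

lemma jf_rpow_half (z : ℝ) (hz : 0 < z) : z ^ (-(1:ℝ)/2) = 1 / √z := by
  rw [Real.sqrt_eq_rpow, neg_div, Real.rpow_neg hz.le, one_div, one_div]

lemma jf_rpow_three_half (z : ℝ) (hz : 0 < z) : z ^ (-(3:ℝ)/2) = 1 / √z ^ 3 := by
  rw [Real.sqrt_eq_rpow, ← Real.rpow_natCast, ← Real.rpow_mul hz.le, neg_div, Real.rpow_neg hz.le,
    one_div]
  norm_num

lemma jf_derivA (a b y x : ℝ) (he : a * y + b ≠ 0) (hx : 0 < x - y) (hv : 0 < a * x + b) :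
    HasDerivAt (fun x => -2 / (a * y + b) * √((a * x + b) / (x - y)))
      (1 / √(a * x + b) * (1 / √(x - y) ^ 3)) x := by
  have h1 : HasDerivAt (fun x => (a * x + b) / (x - y))
      ((a * (x - y) - (a * x + b) * 1) / (x - y) ^ 2) x := by
    have hn : HasDerivAt (fun x => a * x + b) a x := by
      simpa using ((hasDerivAt_id x).const_mul a).add_const b
    exact hn.div ((hasDerivAt_id x).sub_const y) hx.ne'
  have h2 := (h1.sqrt (div_pos hv hx).ne').const_mul (-2 / (a * y + b))
  refine h2.congr_deriv (Eq.symm ?_)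
  rw [Real.sqrt_div hv.le]
  have hr : 0 < √(x - y) := Real.sqrt_pos.2 hx
  have hw : 0 < √(a * x + b) := Real.sqrt_pos.2 hv
  have hr2 : √(x - y) ^ 2 = x - y := Real.sq_sqrt hx.le
  have e : a * (x - y) - (a * x + b) * 1 = -(a * y + b) := by ring
  rw [e, ← hr2, Real.sqrt_sq hr.le]
  field_simp

lemma jf_derivB (a b y t x : ℝ) (hx : 0 < x - y) (hv : 0 < a * x + b) (ht : 0 < t - y)
    (hvt : 0 ≤ a * t + b) :
    HasDerivAt (fun x => -2 * (1 / (x - y) - 1 / (t - y)) /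
        (√((a * x + b) / (x - y)) + √((a * t + b) / (t - y))))
      (1 / √(a * x + b) * (1 / √(x - y) ^ 3)) x := by
  have h1 : HasDerivAt (fun x => (a * x + b) / (x - y))
      ((a * (x - y) - (a * x + b) * 1) / (x - y) ^ 2) x := by
    have hn : HasDerivAt (fun x => a * x + b) a x := by
      simpa using ((hasDerivAt_id x).const_mul a).add_const b
    exact hn.div ((hasDerivAt_id x).sub_const y) hx.ne'
  have h2 := (h1.sqrt (div_pos hv hx).ne').add_const (√((a * t + b) / (t - y)))
  have h3 : HasDerivAt (fun x => -2 * (1 / (x - y) - 1 / (t - y))) (-2 * (-1 / (x - y) ^ 2)) x := by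
    have := ((hasDerivAt_id x).sub_const y).inv hx.ne'
    simpa using (this.sub_const (1 / (t - y))).const_mul (-2)
  have hs : 0 < √((a * x + b) / (x - y)) := Real.sqrt_pos.2 (div_pos hv hx)
  have hS : 0 ≤ √((a * t + b) / (t - y)) := Real.sqrt_nonneg _
  have h4 := h3.div h2 (by positivity)
  refine h4.congr_deriv (Eq.symm ?_)
  have hr : 0 < √(x - y) := Real.sqrt_pos.2 hx
  have hw : 0 < √(a * x + b) := Real.sqrt_pos.2 hv
  have hr2 : √(x - y) ^ 2 = x - y := Real.sq_sqrt hx.le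
  have e : a * (x - y) - (a * x + b) * 1 = -(a * y + b) := by ring
  have hw' : √(a * x + b) = √((a * x + b) / (x - y)) * √(x - y) := by
    rw [Real.sqrt_div hv.le]; field_simp
  have hs2 : √((a * x + b) / (x - y)) ^ 2 = (a * x + b) / (x - y) :=
    Real.sq_sqrt (div_pos hv hx).le
  have hS2 : √((a * t + b) / (t - y)) ^ 2 = (a * t + b) / (t - y) :=
    Real.sq_sqrt (div_nonneg hvt ht.le)
  have key : (a * y + b) * (1 / (x - y) - 1 / (t - y)) =
      √((a * x + b) / (x - y)) ^ 2 - √((a * t + b) / (t - y)) ^ 2 := by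
    rw [hs2, hS2]; field_simp; ring
  rw [e, hw']
  have hr4 : √(x - y) * √(x - y) ^ 3 = (x - y) ^ 2 := by
    rw [← hr2]; rw [Real.sqrt_sq hr.le]; ring
  generalize √((a * x + b) / (x - y)) = s at *
  generalize √((a * t + b) / (t - y)) = S at *
  have e1 : 1 / (s * √(x - y)) * (1 / √(x - y) ^ 3) = 1 / (s * (x - y) ^ 2) := by
    rw [← hr4]; field_simp
  rw [e1]
  have hsS : 0 < s + S := by positivity
  have e2 : -2 * (-1 / (x - y) ^ 2) * (s + S) -
      -2 * (1 / (x - y) - 1 / (t - y)) * (-(a * y + b) / (x - y) ^ 2 / (2 * s)) =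
      (2 * (s + S) - (s ^ 2 - S ^ 2) / s) / (x - y) ^ 2 := by
    rw [← key]
    generalize (1 / (x - y) - 1 / (t - y)) = U
    field_simp
  rw [e2]
  field_simp
  ring

/-- The inner integral in closed form. -/
noncomputable def jfH (p t y x : ℝ) : ℝ :=
  2 / (p^2 + (1-p)^2) * (1 / √((p^2 + (1-p)^2) * |x| + ((1-p)^2 - p^2) * x)
    - 1 / √((p^2 + (1-p)^2) * t + ((1-p)^2 - p^2) * x)) * (1 / √(x - y) ^ 3)

lemma jf_pos (p x : ℝ) (hp : p ∈ Ioo (0:ℝ) 1) (hx : x ≠ 0) :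
    0 < (p^2 + (1-p)^2) * |x| + ((1-p)^2 - p^2) * x := by
  have h0 := hp.1
  have h1 : 0 < 1 - p := by linarith [hp.2]
  rcases lt_or_gt_of_ne hx with h | h
  · rw [abs_of_neg h]
    have : 0 < p^2 * (-x) := mul_pos (by positivity) (by linarith)
    nlinarith
  · rw [abs_of_pos h]
    have : 0 < (1-p)^2 * x := by positivity
    nlinarith

lemma jf_inner (p t y x : ℝ) (hp : p ∈ Ioo (0:ℝ) 1) (hxt : |x| ≤ t) (hx : x ≠ 0)
    (hy : 0 < x - y) :
    (∫ w in |x|..t,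
      (p^2 * (w - x) + (1 - p)^2 * (w + x)) ^ (-(3:ℝ)/2) * (x - y) ^ (-(3:ℝ)/2))
      = jfH p t y x := by
  have hpos := jf_pos p x hp hx
  have hc : 0 < p^2 + (1-p)^2 := by have := hp.1; positivity
  have hpos' : ∀ w, |x| ≤ w → 0 < (p^2 + (1-p)^2) * w + ((1-p)^2 - p^2) * x := by
    intro w hw
    nlinarith
  rw [intervalIntegral.integral_mul_const, jf_rpow_three_half _ hy]
  unfold jfH
  congr 1
  set c := p^2 + (1-p)^2 with hcdef
  set d := (1-p)^2 - p^2 with hd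
  have hD : ∀ w ∈ uIcc |x| t, HasDerivAt (fun w => -(2 / c) * (c * w + d * x) ^ (-(1:ℝ)/2))
      ((p^2 * (w - x) + (1 - p)^2 * (w + x)) ^ (-(3:ℝ)/2)) w := by
    intro w hw
    rw [uIcc_of_le hxt] at hw
    have hw' := hpos' w hw.1
    have hn : HasDerivAt (fun w => c * w + d * x) c w := by
      simpa using ((hasDerivAt_id w).const_mul c).add_const (d * x)
    have h2 := (hn.rpow_const (p := -(1:ℝ)/2) (Or.inl hw'.ne')).const_mul (-(2 / c))
    refine h2.congr_deriv (Eq.symm ?_)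
    have e : p^2 * (w - x) + (1 - p)^2 * (w + x) = c * w + d * x := by rw [hcdef, hd]; ring
    rw [e]
    have e2 : -(1:ℝ)/2 - 1 = -3/2 := by norm_num
    rw [e2]
    field_simp
  rw [intervalIntegral.integral_eq_sub_of_hasDerivAt hD]
  · rw [jf_rpow_half _ (hpos' t hxt), jf_rpow_half _ hpos]
    ring
  · apply ContinuousOn.intervalIntegrable
    apply ContinuousOn.rpow_const (by fun_prop)
    intro w hw
    rw [uIcc_of_le hxt] at hw
    left
    have hw' := hpos' w hw.1
    have e : p^2 * (w - x) + (1 - p)^2 * (w + x) = c * w + d * x := by rw [hcdef, hd]; ring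
    rw [e]
    exact hw'.ne'

lemma jf_nonneg (p t y x : ℝ) (hp : p ∈ Ioo (0:ℝ) 1) (hxt : |x| ≤ t) (hx : x ≠ 0) :
    0 ≤ jfH p t y x := by
  have hpos := jf_pos p x hp hx
  have hc : 0 < p^2 + (1-p)^2 := by have := hp.1; positivity
  have h2 : (p^2 + (1-p)^2) * |x| + ((1-p)^2 - p^2) * x ≤
    (p^2 + (1-p)^2) * t + ((1-p)^2 - p^2) * x := by nlinarith
  have h3 : 1 / √((p^2 + (1-p)^2) * t + ((1-p)^2 - p^2) * x) ≤
      1 / √((p^2 + (1-p)^2) * |x| + ((1-p)^2 - p^2) * x) :=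
    one_div_le_one_div_of_le (Real.sqrt_pos.2 hpos) (Real.sqrt_le_sqrt h2)
  unfold jfH
  have := sub_nonneg.2 h3
  positivity

/-- The uniform antiderivative of the second term. -/
noncomputable def jfB (p t y x : ℝ) : ℝ :=
  -2 * (1 / (x - y) - 1 / (t - y)) /
    (√((((1-p)^2 - p^2) * x + (p^2 + (1-p)^2) * t) / (x - y))
      + √((((1-p)^2 - p^2) * t + (p^2 + (1-p)^2) * t) / (t - y)))

lemma jf_vpos (p t x : ℝ) (hp : p ∈ Ioo (0:ℝ) 1) (ht : 0 < t) (hxt : |x| ≤ t) :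
    0 < ((1-p)^2 - p^2) * x + (p^2 + (1-p)^2) * t := by
  have h0 := hp.1
  have h1 : 0 < 1 - p := by linarith [hp.2]
  obtain ⟨ha, hb⟩ := abs_le.1 hxt
  have e : ((1-p)^2 - p^2) * x + (p^2 + (1-p)^2) * t = (1-p)^2 * (t + x) + p^2 * (t - x) := by ring
  rw [e]
  rcases le_or_gt x 0 with h | h
  · have : 0 < p^2 * (t - x) := mul_pos (by positivity) (by linarith)
    have : 0 ≤ (1-p)^2 * (t + x) := mul_nonneg (by positivity) (by linarith)
    linarith
  · have : 0 ≤ p^2 * (t - x) := mul_nonneg (by positivity) (by linarith)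
    have : 0 < (1-p)^2 * (t + x) := mul_pos (by positivity) (by linarith)
    linarith

lemma jf_B_deriv (p t y x : ℝ) (hp : p ∈ Ioo (0:ℝ) 1) (ht : 0 < t) (hxt : |x| ≤ t)
    (hx : 0 < x - y) :
    HasDerivAt (jfB p t y) (1 / √(((1-p)^2 - p^2) * x + (p^2 + (1-p)^2) * t)
      * (1 / √(x - y) ^ 3)) x := by
  have hty : 0 < t - y := by linarith [(abs_le.1 hxt).2]
  exact jf_derivB _ _ y t x hx (jf_vpos p t x hp ht hxt) hty
    (jf_vpos p t t hp ht (abs_of_pos ht).le).le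

lemma jf_right (p t y : ℝ) (hp : p ∈ Ioo (0:ℝ) 1) (ht : 0 < t) (hy : y ≤ -t) :
    IntervalIntegrable (jfH p t y) volume 0 t ∧ ∫ x in (0:ℝ)..t, jfH p t y x =
      2 / (p^2 + (1-p)^2) * (-2 / (2 * (1-p)^2 * y + 0) * √((2 * (1-p)^2 * t + 0) / (t - y))
        + jfB p t y 0) := by
  have h0 := hp.1
  have h1 : 0 < 1 - p := by linarith [hp.2]
  refine And.imp_right (fun he => he.trans ?_) (jf_ftc (fun x => 2 / (p^2 + (1-p)^2) *
    (-2 / (2 * (1-p)^2 * y + 0) * √((2 * (1-p)^2 * x + 0) / (x - y)) - jfB p t y x))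
    (jfH p t y) 0 t ht.le ?_ ?_ ?_)
  · have hB : ContinuousOn (jfB p t y) (Icc 0 t) := fun x hx =>
      (jf_B_deriv p t y x hp ht (by rw [abs_of_nonneg hx.1]; exact hx.2)
        (by linarith [hx.1])).continuousAt.continuousWithinAt
    have hA : ContinuousOn (fun x => √((2 * (1-p)^2 * x + 0) / (x - y))) (Icc 0 t) := by
      apply ContinuousOn.sqrt
      apply ContinuousOn.div (by fun_prop) (by fun_prop)
      intro x hx
      have h : 0 < x - y := by linarith [hx.1]
      exact h.ne'
    exact continuousOn_const.mul ((continuousOn_const.mul hA).sub hB)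
  · intro x hx
    have hxy : 0 < x - y := by linarith [hx.1]
    have hA := jf_derivA (2 * (1-p)^2) 0 y x
      (by have : y ≠ 0 := by linarith
          rw [add_zero]; positivity) hxy (by have := hx.1; positivity)
    have hB := jf_B_deriv p t y x hp ht (by rw [abs_of_pos hx.1]; exact hx.2.le) hxy
    refine ((hA.sub hB).const_mul (2 / (p^2 + (1-p)^2))).congr_deriv (Eq.symm ?_)
    unfold jfH
    rw [abs_of_pos hx.1]
    have e1 : (p^2 + (1-p)^2) * x + ((1-p)^2 - p^2) * x = 2 * (1-p)^2 * x + 0 := by ring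
    have e2 : (p^2 + (1-p)^2) * t + ((1-p)^2 - p^2) * x =
      ((1-p)^2 - p^2) * x + (p^2 + (1-p)^2) * t := by ring
    rw [e1, e2]
    ring
  · intro x hx
    exact jf_nonneg p t y x hp (by rw [abs_of_pos hx.1]; exact hx.2.le) hx.1.ne'
  · simp [jfB]
    ring

lemma jf_AB_deriv (p t y x : ℝ) (hp : p ∈ Ioo (0:ℝ) 1) (ht : 0 < t) (hy : y ≤ -t)
    (hx : x ∈ Ioo (-t) 0) :
    HasDerivAt (fun x => 2 / (p^2 + (1-p)^2) *
    (-2 / (-2 * p^2 * y + 0) * √((-2 * p^2 * x + 0) / (x - y)) - jfB p t y x)) (jfH p t y x) x := by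
  have h0 := hp.1
  have h1 : 0 < 1 - p := by linarith [hp.2]
  have hxy : 0 < x - y := by linarith [hx.1]
  have hA := jf_derivA (-2 * p^2) 0 y x
    (by have : y ≠ 0 := by linarith
        rw [add_zero]; simp [this, h0.ne']) hxy
    (by have : 0 < p^2 * (-x) := mul_pos (by positivity) (by linarith [hx.2])
        linarith)
  have hB := jf_B_deriv p t y x hp ht (by rw [abs_of_neg hx.2]; linarith [hx.1]) hxy
  refine ((hA.sub hB).const_mul (2 / (p^2 + (1-p)^2))).congr_deriv (Eq.symm ?_)
  unfold jfH
  rw [abs_of_neg hx.2]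
  have e1 : (p^2 + (1-p)^2) * (-x) + ((1-p)^2 - p^2) * x = -2 * p^2 * x + 0 := by ring
  have e2 : (p^2 + (1-p)^2) * t + ((1-p)^2 - p^2) * x =
    ((1-p)^2 - p^2) * x + (p^2 + (1-p)^2) * t := by ring
  rw [e1, e2]
  ring

lemma jf_left (p t y : ℝ) (hp : p ∈ Ioo (0:ℝ) 1) (ht : 0 < t) (hy : y < -t) :
    IntervalIntegrable (jfH p t y) volume (-t) 0 ∧ ∫ x in (-t)..0, jfH p t y x =
      2 / (p^2 + (1-p)^2) * (2 / (-2 * p^2 * y + 0) * √((-2 * p^2 * (-t) + 0) / (-t - y))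
        + jfB p t y (-t) - jfB p t y 0) := by
  have h0 := hp.1
  have h1 : 0 < 1 - p := by linarith [hp.2]
  refine And.imp_right (fun he => he.trans ?_) (jf_ftc _ (jfH p t y) (-t) 0 (by linarith) ?_
    (fun x hx => jf_AB_deriv p t y x hp ht hy.le hx) ?_)
  · have hB : ContinuousOn (jfB p t y) (Icc (-t) 0) := fun x hx =>
      (jf_B_deriv p t y x hp ht (by rw [abs_of_nonpos hx.2]; linarith [hx.1])
        (by linarith [hx.1])).continuousAt.continuousWithinAt
    have hA : ContinuousOn (fun x => √((-2 * p^2 * x + 0) / (x - y))) (Icc (-t) 0) := by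
      apply ContinuousOn.sqrt
      apply ContinuousOn.div (by fun_prop) (by fun_prop)
      intro x hx
      have h : 0 < x - y := by linarith [hx.1]
      exact h.ne'
    exact continuousOn_const.mul ((continuousOn_const.mul hA).sub hB)
  · intro x hx
    exact jf_nonneg p t y x hp (by rw [abs_of_neg hx.2]; linarith [hx.1]) hx.2.ne
  · simp
    ring

lemma jf_split (p t y : ℝ) (hp : p ∈ Ioo (0:ℝ) 1) (ht : 0 < t) (hy : y ≤ -t)
    (h1 : IntervalIntegrable (jfH p t y) volume (-t) 0) :
    (∫ x in (-t)..t, ∫ w in |x|..t,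
          (p^2 * (w - x) + (1 - p)^2 * (w + x)) ^ (-(3:ℝ)/2) * (x - y) ^ (-(3:ℝ)/2)) =
    (∫ x in (-t)..0, jfH p t y x) + ∫ x in (0:ℝ)..t, jfH p t y x := by
  rw [intervalIntegral.integral_add_adjacent_intervals h1 (jf_right p t y hp ht hy).1]
  apply intervalIntegral.integral_congr_ae
  have h0 : ∀ᵐ x : ℝ, x ≠ 0 := by simp [ae_iff]
  filter_upwards [h0] with x hx0 hx
  rw [uIoc_of_le (by linarith)] at hx
  exact jf_inner p t y x hp (abs_le.2 ⟨hx.1.le, hx.2⟩) hx0 (by linarith [hx.1])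

lemma jf_const : (2:ℝ) ^ ((3:ℝ)/2) = 2 * √2 := by
  rw [Real.sqrt_eq_rpow, show (3:ℝ)/2 = 1 + 1/2 by norm_num, Real.rpow_add (by norm_num),
    Real.rpow_one]

lemma jf_left_eq (p t : ℝ) (hp : p ∈ Ioo (0:ℝ) 1) (ht : 0 < t) :
    IntervalIntegrable (jfH p t (-t)) volume (-t) 0 ∧ ∫ x in (-t)..0, jfH p t (-t) x =
      2 / (p^2 + (1-p)^2) * (√(p^2 + (1-p)^2) / (p^2 * t)) := by
  have h0 := hp.1
  have h1 : 0 < 1 - p := by linarith [hp.2]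
  have hc : 0 < p^2 + (1-p)^2 := by positivity
  refine And.imp_right (fun he => he.trans ?_) (jf_ftc (fun x => 2 / (p^2 * t) * (√(x + t) /
    (√(-2 * p^2 * x + 0) + √(((1-p)^2 - p^2) * x + (p^2 + (1-p)^2) * t))))
    (jfH p t (-t)) (-t) 0 (by linarith) ?_ ?_ ?_)
  · apply ContinuousOn.mul continuousOn_const
    apply ContinuousOn.div (by fun_prop) (by fun_prop)
    intro x hx
    have := Real.sqrt_pos.2 (jf_vpos p t x hp ht (by rw [abs_of_nonpos hx.2]; linarith [hx.1]))
    positivity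
  · intro x hx
    have pos1 : ∀ x ∈ Ioo (-t) 0, 0 < -2 * p^2 * x + 0 := by
      intro x hx
      have : 0 < p^2 * (-x) := mul_pos (by positivity) (by linarith [hx.2])
      linarith
    have pos2 : ∀ x ∈ Ioo (-t) 0, 0 < ((1-p)^2 - p^2) * x + (p^2 + (1-p)^2) * t := fun x hx =>
      jf_vpos p t x hp ht (by rw [abs_of_neg hx.2]; linarith [hx.1])
    have E1 : -2 * p^2 * (-t) + 0 = 2 * p^2 * t := by ring
    have E2 : ((1-p)^2 - p^2) * (-t) + (p^2 + (1-p)^2) * t = 2 * p^2 * t := by ring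
    have hxy : 0 < x - -t := by linarith [hx.1]
    have hA := jf_derivA (-2 * p^2) 0 (-t) x (by rw [E1]; positivity) hxy (pos1 x hx)
    have hB := jf_derivA ((1-p)^2 - p^2) ((p^2 + (1-p)^2) * t) (-t) x
      (by rw [E2]; positivity) hxy (pos2 x hx)
    have hD := (hA.sub hB).const_mul (2 / (p^2 + (1-p)^2))
    have hD2 := hD.congr_of_eventuallyEq (f₁ := fun x => 2 / (p^2 * t) * (√(x + t) /
        (√(-2 * p^2 * x + 0) + √(((1-p)^2 - p^2) * x + (p^2 + (1-p)^2) * t)))) (by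
      filter_upwards [isOpen_Ioo.mem_nhds hx] with z hz
      simp only [Pi.sub_apply]
      rw [E1, E2, sub_neg_eq_add, Real.sqrt_div (pos1 z hz).le, Real.sqrt_div (pos2 z hz).le]
      have hz' : 0 < z + t := by linarith [hz.1]
      have k1 := Real.sqrt_pos.2 (pos1 z hz)
      have k2 := Real.sqrt_pos.2 (pos2 z hz)
      have k3 := Real.sqrt_pos.2 hz'
      have s1 := Real.sq_sqrt (pos1 z hz).le
      have s2 := Real.sq_sqrt (pos2 z hz).le
      have s3 := Real.sq_sqrt hz'.le
      generalize √(-2 * p^2 * z + 0) = u at *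
      generalize √(((1-p)^2 - p^2) * z + (p^2 + (1-p)^2) * t) = v at *
      generalize √(z + t) = r at *
      have hrel : (p^2 + (1-p)^2) * r^2 = v^2 - u^2 := by rw [s1, s2, s3]; ring
      generalize p^2 + (1-p)^2 = c at *
      have huv : 0 < u + v := by positivity
      field_simp
      linear_combination hrel)
    refine hD2.congr_deriv (Eq.symm ?_)
    unfold jfH
    rw [abs_of_neg hx.2]
    have e1 : (p^2 + (1-p)^2) * (-x) + ((1-p)^2 - p^2) * x = -2 * p^2 * x + 0 := by ring
    have e2 : (p^2 + (1-p)^2) * t + ((1-p)^2 - p^2) * x =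
      ((1-p)^2 - p^2) * x + (p^2 + (1-p)^2) * t := by ring
    rw [e1, e2]
    ring
  · intro x hx
    exact jf_nonneg p t (-t) x hp (by rw [abs_of_neg hx.2]; linarith [hx.1]) hx.2.ne
  · have hs : 0 < √t := Real.sqrt_pos.2 ht
    have hs' := Real.sqrt_pos.2 hc
    have hs2 := Real.sq_sqrt hc.le
    simp only [mul_zero, zero_add, add_zero, neg_add_cancel, Real.sqrt_zero, zero_div, sub_zero]
    rw [Real.sqrt_mul hc.le]
    generalize p^2 + (1-p)^2 = c at *
    field_simp
    linear_combination -hs2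

theorem jump_first_density_half_left (p t y : ℝ) (hp : p ∈ Ioo (0:ℝ) 1) (ht : 0 < t)
    (hy : y ≤ -t) :
    (p * (1 - p)^2 / (2 ^ ((3:ℝ)/2) * Real.pi)) *
        (∫ x in (-t)..t, ∫ w in |x|..t,
          (p^2 * (w - x) + (1 - p)^2 * (w + x)) ^ (-(3:ℝ)/2) * (x - y) ^ (-(3:ℝ)/2))
      = ((1 - p) / Real.pi) * t ^ ((1:ℝ)/2) /
          (|y| * (p * (t - y) ^ ((1:ℝ)/2) + (1 - p) * (-y - t) ^ ((1:ℝ)/2))) := by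
  have h0 := hp.1
  have h1 : 0 < 1 - p := by linarith [hp.2]
  have hc : 0 < p^2 + (1-p)^2 := by positivity
  have hpi := Real.pi_pos
  have h2 : 0 < √(2:ℝ) := by positivity
  have hT : 0 < √t := Real.sqrt_pos.2 ht
  have hT2 := Real.sq_sqrt ht.le
  have h22 : √(2:ℝ)^2 = 2 := Real.sq_sqrt (by norm_num)
  rw [jf_const, ← Real.sqrt_eq_rpow, ← Real.sqrt_eq_rpow, ← Real.sqrt_eq_rpow]
  rw [abs_of_neg (by linarith : y < 0)]
  rcases hy.lt_or_eq with hlt | heq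
  · obtain ⟨hi, he⟩ := jf_left p t y hp ht hlt
    rw [jf_split p t y hp ht hy hi, he, (jf_right p t y hp ht hy).2]
    unfold jfB
    have hm : 0 < -y - t := by linarith
    have hn : 0 < t - y := by linarith
    have q1 : (-2 * p^2 * (-t) + 0) / (-t - y) = (√2 * p * √t / √(-y - t)) ^ 2 := by
      rw [div_pow, mul_pow, mul_pow, h22, hT2, Real.sq_sqrt hm.le]; ring
    have q2 : (((1-p)^2 - p^2) * (-t) + (p^2 + (1-p)^2) * t) / (-t - y) =
        (√2 * p * √t / √(-y - t)) ^ 2 := by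
      rw [div_pow, mul_pow, mul_pow, h22, hT2, Real.sq_sqrt hm.le]; ring
    have q3 : (((1-p)^2 - p^2) * t + (p^2 + (1-p)^2) * t) / (t - y) =
        (√2 * (1-p) * √t / √(t - y)) ^ 2 := by
      rw [div_pow, mul_pow, mul_pow, h22, hT2, Real.sq_sqrt hn.le]; ring
    have q4 : (2 * (1-p)^2 * t + 0) / (t - y) =
        (√2 * (1-p) * √t / √(t - y)) ^ 2 := by
      rw [div_pow, mul_pow, mul_pow, h22, hT2, Real.sq_sqrt hn.le]; ring
    rw [q1, q2, q3, q4, Real.sqrt_sq (by positivity), Real.sqrt_sq (by positivity)]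
    have km := Real.sqrt_pos.2 hm
    have kn := Real.sqrt_pos.2 hn
    have sm := Real.sq_sqrt hm.le
    have sn := Real.sq_sqrt hn.le
    have em : -t - y = √(-y - t)^2 := by rw [sm]; ring
    generalize -2 * (1 / (0 - y) - 1 / (t - y)) / (√((((1-p)^2 - p^2) * 0 +
      (p^2 + (1-p)^2) * t) / (0 - y)) + √2 * (1-p) * √t / √(t - y)) = Z
    have ey : 1 / (-t - y) - 1 / (t - y) = 2 * √t^2 / (√(-y - t)^2 * √(t - y)^2) := by
      rw [sm, sn, hT2]
      have : 0 < -t - y := by linarith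
      field_simp
      ring
    rw [ey]
    have hY : y = -((√(-y - t)^2 + √(t - y)^2) / 2) := by rw [sm, sn]; ring
    generalize √(-y - t) = m at *
    generalize √(t - y) = n at *
    generalize √t = T at *
    generalize 1 - p = q at *
    have hYp : 0 < -y := by linarith
    obtain ⟨Y, hYd⟩ : ∃ Y, Y = -y := ⟨_, rfl⟩
    have hyY : y = -Y := by rw [hYd]; ring
    rw [← hYd] at hYp
    have hrel : m^2 + n^2 = 2 * Y := by rw [hYd]; linarith
    rw [hyY]
    have key : 2 / (p^2 + q^2) * (2 / (-2 * p^2 * (-Y) + 0) * (√2 * p * T / m) +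
      -2 * (2 * T^2 / (m^2 * n^2)) / (√2 * p * T / m + √2 * q * T / n) - Z) +
      2 / (p^2 + q^2) * (-2 / (2 * q^2 * (-Y) + 0) * (√2 * q * T / n) + Z) =
      2 * √2 * T / (p * q * Y * (p * n + q * m)) := by
      have a1 : 2 / (-2 * p^2 * (-Y) + 0) * (√2 * p * T / m) = √2 * T / (p * Y * m) := by
        have : -2 * p^2 * (-Y) + 0 = 2 * p^2 * Y := by ring
        rw [this]; field_simp
      have a2 : -2 / (2 * q^2 * (-Y) + 0) * (√2 * q * T / n) = √2 * T / (q * Y * n) := by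
        have : 2 * q^2 * (-Y) + 0 = -(2 * q^2 * Y) := by ring
        rw [this]; field_simp
      have a3 : -2 * (2 * T^2 / (m^2 * n^2)) / (√2 * p * T / m + √2 * q * T / n) =
          -(√2 * T * 2 / (m * n * (p * n + q * m))) := by
        have : √2 * p * T / m + √2 * q * T / n = √2 * T * (p * n + q * m) / (m * n) := by
          field_simp
        rw [this]
        field_simp
        linear_combination h22
      rw [a1, a2, a3]
      have a4 : √2 * T / (p * Y * m) + √2 * T / (q * Y * n) -
          √2 * T * 2 / (m * n * (p * n + q * m)) =
          √2 * T * (p^2 + q^2) / (p * q * Y * (p * n + q * m)) := by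
        field_simp
        linear_combination (p * q) * hrel
      calc _ = 2 / (p^2 + q^2) * (√2 * T / (p * Y * m) + √2 * T / (q * Y * n) -
          √2 * T * 2 / (m * n * (p * n + q * m))) := by ring
        _ = _ := by rw [a4]; field_simp
    rw [key, neg_neg]
    field_simp
  · subst heq
    obtain ⟨hi, he⟩ := jf_left_eq p t hp ht
    rw [jf_split p t (-t) hp ht hy hi, he, (jf_right p t (-t) hp ht hy).2]
    unfold jfB
    have q1 : (2 * (1-p)^2 * t + 0) / (t - -t) = (1-p)^2 := by field_simp; ring
    have q2 : (((1-p)^2 - p^2) * 0 + (p^2 + (1-p)^2) * t) / (0 - -t) = p^2 + (1-p)^2 := by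
      rw [sub_neg_eq_add, zero_add]; field_simp; ring
    have q3 : (((1-p)^2 - p^2) * t + (p^2 + (1-p)^2) * t) / (t - -t) = (1-p)^2 := by
      field_simp; ring
    rw [q1, q2, q3, Real.sqrt_sq h1.le]
    have q4 : - -t - t = 0 := by ring
    have q5 : t - -t = 2 * t := by ring
    rw [q4, q5, Real.sqrt_zero, Real.sqrt_mul (by norm_num)]
    have hs' := Real.sqrt_pos.2 hc
    have hs2 := Real.sq_sqrt hc.le
    generalize √(p^2 + (1-p)^2) = C at *
    generalize √t = T at *
    generalize 1 - p = q at *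
    have b1 : -2 * (1 / (0 - -t) - 1 / (2 * t)) / (C + q) = -((C - q) / (p^2 * t)) := by
      rw [sub_neg_eq_add, zero_add]
      field_simp
      linear_combination hs2
    have b2 : -2 / (2 * q^2 * -t + 0) * q = 1 / (q * t) := by
      have : 2 * q^2 * -t + 0 = -(2 * q^2 * t) := by ring
      rw [this]; field_simp
    have key : 2 / (p^2 + q^2) * (C / (p^2 * t)) + 2 / (p^2 + q^2) *
        (1 / (q * t) + -((C - q) / (p^2 * t))) = 2 / (q * p^2 * t) := by
      field_simp
      ring
    rw [b1, b2, key]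
    field_simp
    ring
end
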